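/- Let g, h ∈ SL(2,ℝ). The following are equivalent: (1) the triple (Tr g, Tr h, Tr (g·h)) lies in V, i.e. two of the three numbers Tr g, Tr h, Tr (g·h) are equal to 0 and the third has absolute value greater than 2; (2) the subgroup of SL(2,ℝ) generated by g and h is virtually abelian, and g·h·g⁻¹·h⁻¹ ∉ {I, −I} (the representation is virtually abelian but not abelian as a representation into PSL(2,ℝ)). -/

import Mathlib

/-- The trace of an element of SL(2,ℝ), viewed as a 2×2 real matrix. -/
def trSL (g : Matrix.SpecialLinearGroup (Fin 2) ℝ) : ℝ :=
  Matrix.trace (g : Matrix (Fin 2) (Fin 2) ℝ)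

/-- A group is virtually abelian if it has an abelian subgroup of finite index. -/
def IsVirtuallyAbelian (G : Type*) [Group G] : Prop :=
  ∃ H : Subgroup G, H.FiniteIndex ∧ ∀ a b : H, a * b = b * a

/-- The centralizer of a nonzero traceless real `2 × 2` matrix `K` is spanned by `1` and `K`. -/
lemma exists_eq_smul_one_add_smul_of_commute {K y : Matrix (Fin 2) (Fin 2) ℝ}
    (hK : K ≠ 0) (htr : K.trace = 0) (hy : y * K = K * y) :
    ∃ α β : ℝ, y = α • 1 + β • K := by
  have h00 := congrFun (congrFun hy 0) 0
  have h01 := congrFun (congrFun hy 0) 1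
  have h10 := congrFun (congrFun hy 1) 0
  simp only [Matrix.mul_apply, Fin.sum_univ_two] at h00 h01 h10
  rw [Matrix.trace_fin_two] at htr
  have h11 : K 1 1 = -K 0 0 := by linarith
  rw [h11] at h01 h10
  have key : ∀ β : ℝ, y 0 1 = β * K 0 1 → y 1 0 = β * K 1 0 →
      y 0 0 - y 1 1 = 2 * β * K 0 0 → ∃ α β : ℝ, y = α • 1 + β • K := by
    intro β h1 h2 h3
    refine ⟨y 0 0 - β * K 0 0, β, ?_⟩
    ext i j
    fin_cases i <;> fin_cases j <;> simp [h11, h1, h2]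
    linarith
  by_cases hb : K 0 1 = 0
  · by_cases hc : K 1 0 = 0
    · have ha : K 0 0 ≠ 0 := by
        intro ha
        apply hK
        ext i j
        fin_cases i <;> fin_cases j <;> simp [h11, ha, hb, hc]
      refine key ((y 0 0 - y 1 1) / (2 * K 0 0)) ?_ ?_ ?_
      · rw [hb] at h01 ⊢
        have : K 0 0 * y 0 1 = 0 := by linarith
        simpa [ha] using this
      · rw [hc] at h10 ⊢
        have : K 0 0 * y 1 0 = 0 := by linarith
        simpa [ha] using this
      · field_simp
    · refine key (y 1 0 / K 1 0) ?_ ?_ ?_ <;> field_simp <;> linarith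
  · refine key (y 0 1 / K 0 1) ?_ ?_ ?_ <;> field_simp <;> linarith

lemma commute_of_commute_traceless {K x y : Matrix (Fin 2) (Fin 2) ℝ}
    (hK : K ≠ 0) (htr : K.trace = 0) (hx : x * K = K * x) (hy : y * K = K * y) :
    x * y = y * x := by
  obtain ⟨α, β, rfl⟩ := exists_eq_smul_one_add_smul_of_commute hK htr hy
  simp [mul_add, add_mul, hx]

lemma trace_eq_zero_of_anticommute {K x : Matrix (Fin 2) (Fin 2) ℝ}
    (hK : K ≠ 0) (htr : K.trace = 0) (hx : x * K = -(K * x)) : x.trace = 0 := by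
  by_contra hne
  have h00 := congrFun (congrFun hx 0) 0
  have h01 := congrFun (congrFun hx 0) 1
  have h10 := congrFun (congrFun hx 1) 0
  have h11 := congrFun (congrFun hx 1) 1
  simp only [Matrix.mul_apply, Matrix.neg_apply, Fin.sum_univ_two] at h00 h01 h10 h11
  rw [Matrix.trace_fin_two] at htr hne
  have hd : K 1 1 = -K 0 0 := by linarith
  rw [hd] at h01 h10 h11
  have ha : (x 0 0 + x 1 1) * K 0 0 = 0 := by linarith
  have hb : (x 0 0 + x 1 1) * K 0 1 = 0 := by linarith
  have hc : (x 0 0 + x 1 1) * K 1 0 = 0 := by linarith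
  simp only [mul_eq_zero, hne, false_or] at ha hb hc
  apply hK
  ext i j
  fin_cases i <;> fin_cases j <;> simp [ha, hb, hc, hd]

/-- A nonzero traceless matrix anticommuting with an element of `SL(2,ℝ)` has negative
determinant. -/
lemma det_neg_of_anticommute {K x : Matrix (Fin 2) (Fin 2) ℝ}
    (hK : K ≠ 0) (htr : K.trace = 0) (hdet : x.det = 1) (hx : x * K = -(K * x)) :
    K.det < 0 := by
  have hxt := trace_eq_zero_of_anticommute hK htr hx
  have h00 := congrFun (congrFun hx 0) 0
  simp only [Matrix.mul_apply, Matrix.neg_apply, Fin.sum_univ_two] at h00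
  rw [Matrix.trace_fin_two] at htr hxt
  rw [Matrix.det_fin_two] at hdet ⊢
  have hd : K 1 1 = -K 0 0 := by linarith
  have hs : x 1 1 = -x 0 0 := by linarith
  rw [hd]
  rw [hs] at hdet
  have hqr : x 0 1 * x 1 0 = -(1 + x 0 0 ^ 2) := by linarith
  have hsum : 2 * (x 0 0 * K 0 0) = -(x 0 1 * K 1 0 + K 0 1 * x 1 0) := by linarith
  -- the discriminant of the quadratic form bounds `det K`
  have hid : 4 * (1 + x 0 0 ^ 2) * (K 0 0 ^ 2 + K 0 1 * K 1 0)
      = (x 0 1 * K 1 0 - K 0 1 * x 1 0) ^ 2 + 4 * K 0 0 ^ 2 := by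
    linear_combination (2 * (x 0 0 * K 0 0) - (x 0 1 * K 1 0 + K 0 1 * x 1 0)) * hsum
      + (4 * K 0 1 * K 1 0) * hqr
  have hpos : 0 < (x 0 1 * K 1 0 - K 0 1 * x 1 0) ^ 2 + 4 * K 0 0 ^ 2 := by
    by_contra! hle
    have ha : K 0 0 = 0 := by nlinarith [sq_nonneg (x 0 1 * K 1 0 - K 0 1 * x 1 0)]
    have hdiff : x 0 1 * K 1 0 - K 0 1 * x 1 0 = 0 := by
      nlinarith [sq_nonneg (K 0 0)]
    rw [ha] at hsum
    have hq : x 0 1 ≠ 0 := by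
      intro h0
      rw [h0] at hqr
      nlinarith [sq_nonneg (x 0 0)]
    have hr : x 1 0 ≠ 0 := by
      intro h0
      rw [h0] at hqr
      nlinarith [sq_nonneg (x 0 0)]
    have hc : x 0 1 * K 1 0 = 0 := by linarith
    have hb : K 0 1 * x 1 0 = 0 := by linarith
    simp only [mul_eq_zero, hq, hr, false_or, or_false] at hb hc
    apply hK
    ext i j
    fin_cases i <;> fin_cases j <;> simp [ha, hb, hc, hd]
  have hp : 0 < 4 * (1 + x 0 0 ^ 2) := by positivity
  rw [← hid] at hpos
  have := pos_of_mul_pos_right hpos hp.le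
  linarith

lemma two_lt_abs_trace {K y : Matrix (Fin 2) (Fin 2) ℝ}
    (hK : K ≠ 0) (htr : K.trace = 0) (hneg : K.det < 0) (hdet : y.det = 1)
    (hy : y * K = K * y) (hscalar : ∀ c : ℝ, y ≠ c • 1) : 2 < |y.trace| := by
  obtain ⟨α, β, rfl⟩ := exists_eq_smul_one_add_smul_of_commute hK htr hy
  have hβ : β ≠ 0 := by
    rintro rfl
    exact hscalar α (by simp)
  have ht : (α • (1 : Matrix (Fin 2) (Fin 2) ℝ) + β • K).trace = 2 * α := by
    simp [htr, mul_comm]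
  rw [ht]
  rw [Matrix.trace_fin_two] at htr
  have hd : K 1 1 = -K 0 0 := by linarith
  have hα : α ^ 2 + β ^ 2 * K.det = 1 := by
    rw [← hdet]
    simp [Matrix.det_fin_two, hd]
    ring
  have hβ2 : 0 < β ^ 2 := by positivity
  have h1 : 1 < α ^ 2 := by nlinarith
  have h2 : 1 < |α| := (one_lt_sq_iff_one_lt_abs α).1 h1
  rw [abs_mul, abs_two]
  linarith

open Matrix.SpecialLinearGroup in
/-- Averaging the conjugates of a rotation over a finite subgroup of `SL(2,ℝ)` yields a nonzero
traceless matrix in its centralizer. -/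
lemma exists_traceless_commute_of_finite
    (S : Subgroup (Matrix.SpecialLinearGroup (Fin 2) ℝ)) [Finite S] :
    ∃ K : Matrix (Fin 2) (Fin 2) ℝ, K ≠ 0 ∧ K.trace = 0 ∧
      ∀ x ∈ S, (x : Matrix (Fin 2) (Fin 2) ℝ) * K = K * x := by
  have := Fintype.ofFinite S
  let J : Matrix (Fin 2) (Fin 2) ℝ := !![0, 1; -1, 0]
  let f : S → Matrix (Fin 2) (Fin 2) ℝ := fun y =>
    ((y : Matrix.SpecialLinearGroup (Fin 2) ℝ) : Matrix (Fin 2) (Fin 2) ℝ) * J *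
      ((y : Matrix.SpecialLinearGroup (Fin 2) ℝ)⁻¹ : Matrix.SpecialLinearGroup (Fin 2) ℝ)
  refine ⟨∑ y, f y, ?_, ?_, ?_⟩
  · intro h0
    have h := congrFun (congrFun h0 0) 1
    rw [Matrix.sum_apply] at h
    have hpos : 0 < ∑ y, f y 0 1 := by
      apply Finset.sum_pos _ Finset.univ_nonempty
      rintro ⟨y, hy⟩ -
      have hdet := y.det_coe
      rw [Matrix.det_fin_two] at hdet
      have : f ⟨y, hy⟩ 0 1 = y.1 0 0 ^ 2 + y.1 0 1 ^ 2 := by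
        simp [f, J, Matrix.mul_apply, Fin.sum_univ_two, coe_inv, Matrix.adjugate_fin_two]
        ring
      rw [this]
      by_contra! hle
      have h1 : y.1 0 0 = 0 := by nlinarith [sq_nonneg (y.1 0 0), sq_nonneg (y.1 0 1)]
      have h2 : y.1 0 1 = 0 := by nlinarith [sq_nonneg (y.1 0 0), sq_nonneg (y.1 0 1)]
      rw [h1, h2] at hdet
      norm_num at hdet
    exact hpos.ne' h
  · rw [Matrix.trace_sum]
    apply Finset.sum_eq_zero
    intro y _
    simp only [f]
    rw [Matrix.trace_mul_comm, ← mul_assoc, ← coe_mul]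
    simp [J, Matrix.trace_fin_two]
  · intro x hx
    rw [Finset.mul_sum, Finset.sum_mul, ← Equiv.sum_comp (Equiv.mulLeft (⟨x, hx⟩ : S))
      (fun y => f y * (x : Matrix (Fin 2) (Fin 2) ℝ))]
    refine Finset.sum_congr rfl fun y _ => ?_
    simp only [f, Equiv.coe_mulLeft, Subgroup.coe_mul, mul_inv_rev, coe_mul]
    simp only [mul_assoc]
    rw [← coe_mul x⁻¹ x]
    simp

/-- A virtually abelian subgroup of `SL(2,ℝ)` commutes up to sign with some nonzero traceless
matrix. -/
lemma IsVirtuallyAbelian.exists_traceless {S : Subgroup (Matrix.SpecialLinearGroup (Fin 2) ℝ)}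
    (hS : IsVirtuallyAbelian S) :
    ∃ K : Matrix (Fin 2) (Fin 2) ℝ, K ≠ 0 ∧ K.trace = 0 ∧
      ∀ x ∈ S, (x : Matrix (Fin 2) (Fin 2) ℝ) * K = K * x ∨
        (x : Matrix (Fin 2) (Fin 2) ℝ) * K = -(K * x) := by
  obtain ⟨H, hfin, hab⟩ := hS
  have hle := H.normalCore_le
  have hcomm : ∀ a ∈ H.normalCore, ∀ b ∈ H.normalCore, a * b = b * a := fun a ha b hb =>
    congrArg Subtype.val (hab ⟨a, hle ha⟩ ⟨b, hle hb⟩)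
  by_cases hsc : ∀ k ∈ H.normalCore,
      ∃ c : ℝ, ((k : Matrix.SpecialLinearGroup (Fin 2) ℝ) : Matrix (Fin 2) (Fin 2) ℝ) = c • 1
  · have hNfin : Finite H.normalCore := by
      have hval : ∀ k : H.normalCore,
          ((k : S) : Matrix.SpecialLinearGroup (Fin 2) ℝ) ∈
            ({1, -1} : Set (Matrix.SpecialLinearGroup (Fin 2) ℝ)) := by
        rintro ⟨k, hk⟩
        obtain ⟨c, hc⟩ := hsc k hk
        have hdet := k.1.det_coe
        rw [hc] at hdet
        simp at hdet
        rcases hdet with rfl | rfl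
        · left; ext i j; simp [hc]
        · right; ext i j; simp [hc]
      refine Finite.of_injective (β := ({1, -1} : Set (Matrix.SpecialLinearGroup (Fin 2) ℝ)))
        (fun k => ⟨_, hval k⟩) ?_
      intro a b h
      exact Subtype.ext (Subtype.ext (Subtype.mk.inj h))
    have : Finite S := by
      have := H.normalCore.finite_quotient_of_finiteIndex
      exact Finite.of_equiv _ H.normalCore.groupEquivQuotientProdSubgroup.symm
    obtain ⟨K, h1, h2, h3⟩ := exists_traceless_commute_of_finite S
    exact ⟨K, h1, h2, fun x hx => Or.inl (h3 x hx)⟩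
  · push Not at hsc
    obtain ⟨k, hk, hns⟩ := hsc
    set k' : Matrix (Fin 2) (Fin 2) ℝ :=
      ((k : Matrix.SpecialLinearGroup (Fin 2) ℝ) : Matrix (Fin 2) (Fin 2) ℝ) with hk'
    let K : Matrix (Fin 2) (Fin 2) ℝ := k' - (k'.trace / 2) • 1
    have hK0 : K ≠ 0 := fun h => hns _ (sub_eq_zero.1 h)
    have hKt : K.trace = 0 := by simp [K]
    have hNK : ∀ y ∈ H.normalCore,
        ((y : Matrix.SpecialLinearGroup (Fin 2) ℝ) : Matrix (Fin 2) (Fin 2) ℝ) * K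
          = K * (y : Matrix.SpecialLinearGroup (Fin 2) ℝ) := by
      intro y hy
      have h := congrArg
        (fun z : S => ((z : Matrix.SpecialLinearGroup (Fin 2) ℝ) : Matrix (Fin 2) (Fin 2) ℝ))
        (hcomm y hy k hk)
      simp only [Subgroup.coe_mul, Matrix.SpecialLinearGroup.coe_mul] at h
      simp [K, mul_sub, sub_mul, hk', h]
    refine ⟨K, hK0, hKt, fun x hx => ?_⟩
    have hxi : (x : Matrix (Fin 2) (Fin 2) ℝ) *
        ((x⁻¹ : Matrix.SpecialLinearGroup (Fin 2) ℝ) : Matrix (Fin 2) (Fin 2) ℝ) = 1 := by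
      rw [← Matrix.SpecialLinearGroup.coe_mul]; simp
    have hix : ((x⁻¹ : Matrix.SpecialLinearGroup (Fin 2) ℝ) : Matrix (Fin 2) (Fin 2) ℝ) *
        (x : Matrix (Fin 2) (Fin 2) ℝ) = 1 := by
      rw [← Matrix.SpecialLinearGroup.coe_mul]; simp
    have hconj := hNK _ (Subgroup.Normal.conj_mem inferInstance k hk ⟨x, hx⟩)
    obtain ⟨α, β, hαβ⟩ := exists_eq_smul_one_add_smul_of_commute hK0 hKt hconj
    simp only [Subgroup.coe_mul, Subgroup.coe_inv, Matrix.SpecialLinearGroup.coe_mul] at hαβ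
    rw [← hk'] at hαβ
    have htr := congrArg Matrix.trace hαβ
    rw [Matrix.trace_mul_comm, ← mul_assoc, hix, one_mul, Matrix.trace_add, Matrix.trace_smul,
      Matrix.trace_smul, hKt] at htr
    have hα : α = k'.trace / 2 := by
      simp at htr
      linarith
    have hxK : (x : Matrix (Fin 2) (Fin 2) ℝ) * K = β • (K * x) := by
      have h := congrArg (· * (x : Matrix (Fin 2) (Fin 2) ℝ)) hαβ
      simp only [mul_assoc, hix, mul_one, add_mul, smul_mul_assoc, one_mul] at h
      have hexp : (x : Matrix (Fin 2) (Fin 2) ℝ) * K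
          = x * k' - (k'.trace / 2) • (x : Matrix (Fin 2) (Fin 2) ℝ) := by
        simp [K, mul_sub]
      rw [hexp, h, hα, add_sub_cancel_left]
    have hpow : ∀ n : ℕ, (x : Matrix (Fin 2) (Fin 2) ℝ) ^ n * K
        = β ^ n • (K * (x : Matrix (Fin 2) (Fin 2) ℝ) ^ n) := by
      intro n
      induction n with
      | zero => simp
      | succ n ih =>
        rw [pow_succ, mul_assoc, hxK, mul_smul_comm, ← mul_assoc, ih, smul_mul_assoc, smul_smul,
          mul_assoc, pow_succ β, mul_comm β]
    have hmem := H.normalCore.pow_index_mem ⟨x, hx⟩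
    set n := H.normalCore.index
    have hn0 : n ≠ 0 := Subgroup.FiniteIndex.index_ne_zero
    have h := hNK _ hmem
    simp only [SubgroupClass.coe_pow, Matrix.SpecialLinearGroup.coe_pow] at h
    rw [hpow n] at h
    have hβn : β ^ n = 1 := by
      have h' : (β ^ n - 1) • (K * (x : Matrix (Fin 2) (Fin 2) ℝ) ^ n) = 0 := by
        rw [sub_smul, h, one_smul, sub_self]
      rcases smul_eq_zero.1 h' with h' | h'
      · linarith
      · exfalso
        apply hK0
        have hu : IsUnit ((x : Matrix (Fin 2) (Fin 2) ℝ) ^ n) :=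
          (IsUnit.of_mul_eq_one _ hxi).pow n
        simpa using hu.mul_left_eq_zero.1 h'
    have hβ : |β| = 1 := by
      rw [← pow_eq_one_iff_of_nonneg (abs_nonneg β) hn0, ← abs_pow, hβn, abs_one]
    rcases eq_or_eq_neg_of_abs_eq hβ with rfl | rfl
    · left; simpa using hxK
    · right; simpa using hxK

/-- If every generator fixes or inverts `k` under conjugation and one of them inverts it, then the
centralizer of the nonscalar element `k` is an abelian subgroup of index two. -/
lemma isVirtuallyAbelian_closure_of_conj {s : Set (Matrix.SpecialLinearGroup (Fin 2) ℝ)}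
    {k a : Matrix.SpecialLinearGroup (Fin 2) ℝ} (ha : a ∈ s) (hak : a * k * a⁻¹ = k⁻¹)
    (hk : k⁻¹ ≠ k)
    (hs : ∀ x ∈ s, x * k * x⁻¹ = k ∨ x * k * x⁻¹ = k⁻¹) :
    IsVirtuallyAbelian (Subgroup.closure s) := by
  have hall : ∀ x ∈ Subgroup.closure s, x * k * x⁻¹ = k ∨ x * k * x⁻¹ = k⁻¹ := by
    intro x hx
    induction hx using Subgroup.closure_induction with
    | mem x hx => exact hs x hx
    | one => simp
    | mul x y _ _ hx hy =>
      have hxinv : (x * k * x⁻¹)⁻¹ = x * k⁻¹ * x⁻¹ := by group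
      have hxy : x * y * k * (x * y)⁻¹ = x * (y * k * y⁻¹) * x⁻¹ := by group
      rw [hxy]
      rcases hy with hy | hy <;> rw [hy]
      · exact hx
      · rw [← hxinv]
        rcases hx with hx | hx <;> rw [hx] <;> simp
    | inv x _ hx =>
      rcases hx with hx | hx
      · left
        nth_rewrite 1 [← hx]
        group
      · right
        have h : k = (x * k * x⁻¹)⁻¹ := by rw [hx, inv_inv]
        nth_rewrite 1 [h]
        group
  let H : Subgroup (Subgroup.closure s) :=
    (Subgroup.centralizer {k}).subgroupOf (Subgroup.closure s)
  have hmem : ∀ x : Subgroup.closure s, x ∈ H ↔ x.1 * k * x.1⁻¹ = k := by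
    intro x
    simp only [H, Subgroup.mem_subgroupOf, Subgroup.mem_centralizer_singleton_iff]
    rw [mul_inv_eq_iff_eq_mul]
  refine ⟨H, ?_, ?_⟩
  · have : H.index = 2 := by
      refine Subgroup.index_eq_two_iff.2 ⟨⟨a, Subgroup.subset_closure ha⟩, fun b => ?_⟩
      rw [hmem, hmem]
      have hba : b.1 * a * k * (b.1 * a)⁻¹ = (b.1 * k * b.1⁻¹)⁻¹ := by
        rw [show b.1 * a * k * (b.1 * a)⁻¹ = b.1 * (a * k * a⁻¹) * b.1⁻¹ by group, hak]
        group
      simp only [Subgroup.coe_mul, hba]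
      rcases hall b.1 b.2 with h | h <;> rw [h]
      · exact Or.inr ⟨rfl, hk⟩
      · exact Or.inl ⟨inv_inv k, hk⟩
    exact ⟨by rw [this]; norm_num⟩
  · set k' : Matrix (Fin 2) (Fin 2) ℝ := (k : Matrix (Fin 2) (Fin 2) ℝ) with hk'
    let K : Matrix (Fin 2) (Fin 2) ℝ := k' - (k'.trace / 2) • 1
    have hKt : K.trace = 0 := by simp [K]
    have hK0 : K ≠ 0 := by
      intro h0
      have hc := sub_eq_zero.1 h0
      have hcent : a * k * a⁻¹ = k := by
        rw [mul_inv_eq_iff_eq_mul]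
        apply Subtype.ext
        change (a : Matrix (Fin 2) (Fin 2) ℝ) * k' = k' * a
        rw [hc]
        simp
      exact hk (hak.symm.trans hcent)
    have hHK : ∀ y ∈ H, ((y : Matrix.SpecialLinearGroup (Fin 2) ℝ) : Matrix (Fin 2) (Fin 2) ℝ) * K
        = K * (y : Matrix.SpecialLinearGroup (Fin 2) ℝ) := by
      intro y hy
      have h := congrArg
        (fun z : Matrix.SpecialLinearGroup (Fin 2) ℝ => (z : Matrix (Fin 2) (Fin 2) ℝ))
        (mul_inv_eq_iff_eq_mul.1 ((hmem y).1 hy))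
      simp only [Matrix.SpecialLinearGroup.coe_mul] at h
      simp [K, mul_sub, sub_mul, hk', h]
    intro x y
    apply Subtype.ext
    apply Subtype.ext
    apply Subtype.ext
    exact commute_of_commute_traceless hK0 hKt (hHK _ x.2) (hHK _ y.2)

lemma mul_self_eq_neg_one_of_trSL_eq_zero {x : Matrix.SpecialLinearGroup (Fin 2) ℝ}
    (hx : trSL x = 0) : x * x = -1 := by
  have hdet := x.det_coe
  rw [Matrix.det_fin_two] at hdet
  rw [trSL, Matrix.trace_fin_two] at hx
  have hs : x.1 1 1 = -x.1 0 0 := by linarith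
  rw [hs] at hdet
  ext i j
  fin_cases i <;> fin_cases j <;> simp [Matrix.mul_apply, Fin.sum_univ_two, hs] <;> linarith

lemma inv_eq_neg_of_trSL_eq_zero {x : Matrix.SpecialLinearGroup (Fin 2) ℝ}
    (hx : trSL x = 0) : x⁻¹ = -x := by
  rw [inv_eq_iff_mul_eq_one, mul_neg, mul_self_eq_neg_one_of_trSL_eq_zero hx, neg_neg]

lemma inv_ne_self_of_two_lt_abs_trSL {k : Matrix.SpecialLinearGroup (Fin 2) ℝ}
    (hk : 2 < |trSL k|) : k⁻¹ ≠ k := by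
  intro h
  have hdet := k.det_coe
  have h00 := congrFun (congrFun (congrArg Subtype.val h) 0) 0
  have h01 := congrFun (congrFun (congrArg Subtype.val h) 0) 1
  rw [Matrix.det_fin_two] at hdet
  simp [Matrix.adjugate_fin_two] at h00 h01
  rw [trSL, Matrix.trace_fin_two, h00] at hk
  have h01' : k.1 0 1 = 0 := by linarith
  rw [h01', h00] at hdet
  have h1 : |k.1 0 0| ≤ 1 := (sq_le_one_iff_abs_le_one _).1 (by nlinarith)
  rw [← two_mul, abs_mul, abs_two] at hk
  linarith

lemma trSL_commutator (g h : Matrix.SpecialLinearGroup (Fin 2) ℝ) :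
    trSL (g * h * g⁻¹ * h⁻¹) = trSL g ^ 2 + trSL h ^ 2 + trSL (g * h) ^ 2
      - trSL g * trSL h * trSL (g * h) - 2 := by
  have hg := g.det_coe
  have hh := h.det_coe
  rw [Matrix.det_fin_two] at hg hh
  simp [trSL, Matrix.trace_fin_two, Matrix.mul_apply, Fin.sum_univ_two, Matrix.adjugate_fin_two]
  linear_combination ((g.1 0 0 + g.1 1 1) ^ 2 - 2) * hh
    + ((h.1 0 0 + h.1 1 1) ^ 2 - 2 * (h.1 0 0 * h.1 1 1 - h.1 0 1 * h.1 1 0)) * hg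

lemma commutator_ne_of_two_lt_trSL {c : Matrix.SpecialLinearGroup (Fin 2) ℝ} (hc : 2 < trSL c) :
    (c : Matrix (Fin 2) (Fin 2) ℝ) ≠ 1 ∧ (c : Matrix (Fin 2) (Fin 2) ℝ) ≠ -1 := by
  constructor <;> intro h <;> rw [trSL, h] at hc <;> norm_num [Matrix.trace_fin_two] at hc

/-- The triple `(Tr g, Tr h, Tr gh)` lies in `V` — two of the coordinates are `0`
and the third has absolute value greater than `2` — if and only if the subgroup
of SL(2,ℝ) generated by `g` and `h` is virtually abelian and the commutator
`[g,h]` is not `±I` (the representation is virtually abelian but not abelian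
as a representation into PSL(2,ℝ)). -/
theorem stmt7 (g h : Matrix.SpecialLinearGroup (Fin 2) ℝ) :
    ((trSL g = 0 ∧ trSL h = 0 ∧ 2 < |trSL (g * h)|) ∨
     (trSL g = 0 ∧ trSL (g * h) = 0 ∧ 2 < |trSL h|) ∨
     (trSL h = 0 ∧ trSL (g * h) = 0 ∧ 2 < |trSL g|)) ↔
    (IsVirtuallyAbelian (Subgroup.closure ({g, h} : Set (Matrix.SpecialLinearGroup (Fin 2) ℝ))) ∧
      ((g * h * g⁻¹ * h⁻¹ : Matrix.SpecialLinearGroup (Fin 2) ℝ) : Matrix (Fin 2) (Fin 2) ℝ) ≠ 1 ∧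
      ((g * h * g⁻¹ * h⁻¹ : Matrix.SpecialLinearGroup (Fin 2) ℝ) : Matrix (Fin 2) (Fin 2) ℝ) ≠ -1) := by
  constructor
  · intro hyp
    rcases hyp with ⟨hg, hh, hk⟩ | ⟨hg, hk, hh⟩ | ⟨hh, hk, hg⟩
    · refine ⟨?_, commutator_ne_of_two_lt_trSL ?_⟩
      · have hgi := inv_eq_neg_of_trSL_eq_zero hg
        have hhi := inv_eq_neg_of_trSL_eq_zero hh
        have h1 : g * (g * h) * g⁻¹ = (g * h)⁻¹ := by
          rw [mul_inv_rev, ← mul_assoc, mul_self_eq_neg_one_of_trSL_eq_zero hg, hhi]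
          simp
        have h2 : h * (g * h) * h⁻¹ = (g * h)⁻¹ := by
          rw [mul_inv_rev, ← mul_assoc, mul_inv_cancel_right, hhi, hgi, neg_mul_neg]
        refine isVirtuallyAbelian_closure_of_conj (a := g) (by simp) h1
          (inv_ne_self_of_two_lt_abs_trSL hk) ?_
        rintro x (rfl | rfl)
        · exact Or.inr h1
        · exact Or.inr h2
      · rw [trSL_commutator, hg, hh]
        nlinarith [sq_abs (trSL (g * h))]
    · refine ⟨?_, commutator_ne_of_two_lt_trSL ?_⟩
      · have hgi := inv_eq_neg_of_trSL_eq_zero hg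
        have h1 : g * h * g⁻¹ = h⁻¹ := by
          have h2 := mul_self_eq_neg_one_of_trSL_eq_zero hk
          rw [eq_inv_iff_mul_eq_one, hgi, mul_neg, neg_mul, mul_assoc, h2, neg_neg]
        refine isVirtuallyAbelian_closure_of_conj (a := g) (by simp) h1
          (inv_ne_self_of_two_lt_abs_trSL hh) ?_
        rintro x (rfl | rfl)
        · exact Or.inr h1
        · exact Or.inl (by group)
      · rw [trSL_commutator, hg, hk]
        nlinarith [sq_abs (trSL h)]
    · refine ⟨?_, commutator_ne_of_two_lt_trSL ?_⟩
      · have hhi := inv_eq_neg_of_trSL_eq_zero hh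
        have h1 : h * g * h⁻¹ = g⁻¹ := by
          have h2 := mul_self_eq_neg_one_of_trSL_eq_zero hk
          apply eq_inv_of_mul_eq_one_right
          rw [hhi, mul_neg, mul_neg, mul_assoc h, ← mul_assoc g, h2, neg_neg]
        refine isVirtuallyAbelian_closure_of_conj (a := h) (by simp) h1
          (inv_ne_self_of_two_lt_abs_trSL hg) ?_
        rintro x (rfl | rfl)
        · exact Or.inl (by group)
        · exact Or.inr h1
      · rw [trSL_commutator, hh, hk]
        nlinarith [sq_abs (trSL g)]
  · rintro ⟨hva, hne, -⟩
    obtain ⟨K, hK, htr, hS⟩ := hva.exists_traceless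
    have hnc : (g : Matrix (Fin 2) (Fin 2) ℝ) * h ≠ h * g := by
      intro hc
      apply hne
      have hc' : g * h = h * g := Subtype.ext hc
      rw [hc']
      simp
    have hgs : ∀ c : ℝ, (g : Matrix (Fin 2) (Fin 2) ℝ) ≠ c • 1 := by
      intro c hc
      exact hnc (by simp [hc])
    have hhs : ∀ c : ℝ, (h : Matrix (Fin 2) (Fin 2) ℝ) ≠ c • 1 := by
      intro c hc
      exact hnc (by simp [hc])
    have hghs : ∀ c : ℝ, ((g * h : Matrix.SpecialLinearGroup (Fin 2) ℝ) :
        Matrix (Fin 2) (Fin 2) ℝ) ≠ c • 1 := by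
      intro c hc
      have hcomm : g * (g * h) = (g * h) * g := by
        apply Subtype.ext
        rw [Matrix.SpecialLinearGroup.coe_mul, Matrix.SpecialLinearGroup.coe_mul (g * h), hc]
        simp
      rw [mul_assoc g h g] at hcomm
      exact hnc (congrArg (fun z : Matrix.SpecialLinearGroup (Fin 2) ℝ =>
        (z : Matrix (Fin 2) (Fin 2) ℝ)) (mul_left_cancel hcomm))
    rcases hS g (Subgroup.subset_closure (by simp)) with hg | hg <;>
      rcases hS h (Subgroup.subset_closure (by simp)) with hh | hh
    · exact absurd (commute_of_commute_traceless hK htr hg hh) hnc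
    · have hgh : ((g * h : Matrix.SpecialLinearGroup (Fin 2) ℝ) : Matrix (Fin 2) (Fin 2) ℝ) * K
          = -(K * (g * h : Matrix.SpecialLinearGroup (Fin 2) ℝ)) := by
        rw [Matrix.SpecialLinearGroup.coe_mul, mul_assoc, hh, mul_neg, ← mul_assoc, hg, mul_assoc]
      exact Or.inr (Or.inr ⟨trace_eq_zero_of_anticommute hK htr hh,
        trace_eq_zero_of_anticommute hK htr hgh,
        two_lt_abs_trace hK htr (det_neg_of_anticommute hK htr h.det_coe hh) g.det_coe hg hgs⟩)
    · have hgh : ((g * h : Matrix.SpecialLinearGroup (Fin 2) ℝ) : Matrix (Fin 2) (Fin 2) ℝ) * K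
          = -(K * (g * h : Matrix.SpecialLinearGroup (Fin 2) ℝ)) := by
        rw [Matrix.SpecialLinearGroup.coe_mul, mul_assoc, hh, ← mul_assoc, hg, neg_mul, mul_assoc]
      exact Or.inr (Or.inl ⟨trace_eq_zero_of_anticommute hK htr hg,
        trace_eq_zero_of_anticommute hK htr hgh,
        two_lt_abs_trace hK htr (det_neg_of_anticommute hK htr g.det_coe hg) h.det_coe hh hhs⟩)
    · have hgh : ((g * h : Matrix.SpecialLinearGroup (Fin 2) ℝ) : Matrix (Fin 2) (Fin 2) ℝ) * K
          = K * (g * h : Matrix.SpecialLinearGroup (Fin 2) ℝ) := by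
        rw [Matrix.SpecialLinearGroup.coe_mul, mul_assoc, hh, mul_neg, ← mul_assoc, hg, neg_mul,
          neg_neg, mul_assoc]
      exact Or.inl ⟨trace_eq_zero_of_anticommute hK htr hg,
        trace_eq_zero_of_anticommute hK htr hh,
        two_lt_abs_trace hK htr (det_neg_of_anticommute hK htr g.det_coe hg)
          (g * h).det_coe hgh hghs⟩
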